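/- Conversely, if every unfolding matrix A^(k) of a d-dimensional tensor 𝒜 has rank at most r_k, then 𝒜 admits an exact TT decomposition with TT-ranks at most r₁,…,r_{d−1}. -/

import Mathlib

/-- Iterating `v k a = ∑ b, H k a b * v (k + 1) b` expresses `v 0` through `v d` as a sum over
paths. -/
lemma sum_prod_mul_eq_sum_mul_of_recurrence {R : Type*} [CommSemiring R] {d : ℕ}
    (ι : Fin (d + 1) → Type*) [∀ k, Fintype (ι k)] (v : (k : Fin (d + 1)) → ι k → R)
    (H : (k : Fin d) → ι k.castSucc → ι k.succ → R)
    (hv : ∀ k a, v k.castSucc a = ∑ b, H k a b * v k.succ b) (w : ι 0 → R) :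
    ∑ α : ((k : Fin (d + 1)) → ι k),
      w (α 0) * (∏ k : Fin d, H k (α k.castSucc) (α k.succ)) * v (Fin.last d) (α (Fin.last d)) =
    ∑ a, w a * v 0 a := by
  induction d with
  | zero =>
    rw [← (Fin.consEquiv ι).sum_comp, Fintype.sum_prod_type]
    simp [Fin.consEquiv]
  | succ d ih =>
    have key := ih (fun k => ι k.succ) (fun k => v k.succ) (fun k => H k.succ)
      (fun k a => hv k.succ a) (fun b => ∑ a, w a * H 0 a b)
    have h0 : ∑ a, w a * v 0 a = ∑ b, (∑ a, w a * H 0 a b) * v (Fin.succ 0) b := by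
      simp_rw [Finset.sum_mul]
      rw [Finset.sum_comm]
      refine Finset.sum_congr rfl fun a _ => ?_
      rw [show v 0 a = _ from hv 0 a, Finset.mul_sum]
      exact Finset.sum_congr rfl fun b _ => (mul_assoc _ _ _).symm
    rw [h0, ← key, ← (Fin.consEquiv ι).sum_comp, Fintype.sum_prod_type, Finset.sum_comm]
    refine Finset.sum_congr rfl fun α _ => ?_
    rw [Finset.sum_mul, Finset.sum_mul]
    refine Finset.sum_congr rfl fun a _ => ?_
    rw [Fin.prod_univ_succ, ← mul_assoc]
    rfl

/-- The span of the rows of the `k`-th unfolding of `A`, each row being regarded as a function of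
all indices that does not depend on the first `k` of them. -/
def unfoldingRowSpace {d : ℕ} {n : Fin d → ℕ} (A : ((i : Fin d) → Fin (n i)) → ℝ) (k : ℕ) :
    Submodule ℝ (((i : Fin d) → Fin (n i)) → ℝ) :=
  Submodule.span ℝ (Set.range fun x y : (i : Fin d) → Fin (n i) =>
    A fun i => if (i : ℕ) < k then x i else y i)

lemma finrank_unfoldingRowSpace_le {d : ℕ} {n : Fin d → ℕ}
    (A : ((i : Fin d) → Fin (n i)) → ℝ) (k : ℕ) :
    Module.finrank ℝ (unfoldingRowSpace A k) ≤ Matrix.rank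
      (Matrix.of fun (x : (i : {i : Fin d // (i : ℕ) < k}) → Fin (n i.1))
          (y : (i : {i : Fin d // ¬ (i : ℕ) < k}) → Fin (n i.1)) =>
        A (fun i => if h : (i : ℕ) < k then x ⟨i, h⟩ else y ⟨i, h⟩)) := by
  rw [Matrix.rank_eq_finrank_span_row]
  let L : (((i : {i : Fin d // ¬ (i : ℕ) < k}) → Fin (n i.1)) → ℝ) →ₗ[ℝ]
      (((i : Fin d) → Fin (n i)) → ℝ) :=
    LinearMap.funLeft ℝ ℝ fun y i => y i.1
  refine le_trans (Submodule.finrank_mono ?_) (Submodule.finrank_map_le L _)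
  rw [unfoldingRowSpace, Submodule.span_le]
  rintro _ ⟨x, rfl⟩
  refine ⟨_, Submodule.subset_span ⟨fun i => x i.1, rfl⟩, ?_⟩
  ext y
  simp only [L, LinearMap.funLeft_apply, Matrix.row, Matrix.of_apply]
  congr 1

lemma mem_unfoldingRowSpace_zero {d : ℕ} {n : Fin d → ℕ} (A : ((i : Fin d) → Fin (n i)) → ℝ) :
    A ∈ unfoldingRowSpace A 0 := by
  cases isEmpty_or_nonempty ((i : Fin d) → Fin (n i)) with
  | inl _ => rw [Subsingleton.elim A 0]; exact zero_mem _
  | inr h => exact Submodule.subset_span ⟨h.some, by simp⟩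

lemma unfoldingRowSpace_le_span_one {d : ℕ} {n : Fin d → ℕ}
    (A : ((i : Fin d) → Fin (n i)) → ℝ) : unfoldingRowSpace A d ≤ Submodule.span ℝ {1} := by
  rw [unfoldingRowSpace, Submodule.span_le]
  rintro _ ⟨x, rfl⟩
  refine Submodule.mem_span_singleton.2 ⟨A x, ?_⟩
  ext y
  simp

/-- Fixing the `k`-th index maps the `k`-th row space into the next one. -/
lemma comp_update_mem_unfoldingRowSpace {d : ℕ} {n : Fin d → ℕ}
    {A : ((i : Fin d) → Fin (n i)) → ℝ} {k : Fin d} (j : Fin (n k))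
    {f : ((i : Fin d) → Fin (n i)) → ℝ} (hf : f ∈ unfoldingRowSpace A k) :
    (fun y => f (Function.update y k j)) ∈ unfoldingRowSpace A (k + 1) := by
  let L : (((i : Fin d) → Fin (n i)) → ℝ) →ₗ[ℝ] (((i : Fin d) → Fin (n i)) → ℝ) :=
    LinearMap.funLeft ℝ ℝ fun y => Function.update y k j
  suffices h : unfoldingRowSpace A k ≤ (unfoldingRowSpace A (k + 1)).comap L from h hf
  rw [unfoldingRowSpace, Submodule.span_le]
  rintro _ ⟨x, rfl⟩
  refine Submodule.subset_span ⟨Function.update x k j, ?_⟩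
  ext y
  simp only [L, LinearMap.funLeft_apply]
  congr 1
  ext i
  rcases eq_or_ne i k with rfl | hik
  · simp
  · have : (i : ℕ) ≠ k := fun h => hik (Fin.ext h)
    have h : (i : ℕ) < k + 1 ↔ (i : ℕ) < k := by omega
    simp [h, hik]

/-- If every unfolding matrix of a d-dimensional tensor has rank at most r k,
    then the tensor admits an exact TT decomposition with TT-ranks at most r. -/
theorem exists_tt_decomposition_of_unfolding_rank_le
    (d : ℕ) (hd : 1 ≤ d) (n : Fin d → ℕ) (r : Fin (d + 1) → ℕ)
    (A : ((i : Fin d) → Fin (n i)) → ℝ)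
    (hrank : ∀ k : Fin (d + 1),
      Matrix.rank
        (Matrix.of fun (x : (i : {i : Fin d // (i : ℕ) < (k : ℕ)}) → Fin (n i.1))
            (y : (i : {i : Fin d // ¬ (i : ℕ) < (k : ℕ)}) → Fin (n i.1)) =>
          A (fun i => if h : (i : ℕ) < (k : ℕ) then x ⟨i, h⟩ else y ⟨i, h⟩)) ≤ r k) :
    ∃ r' : Fin (d + 1) → ℕ,
      r' 0 = 1 ∧ r' (Fin.last d) = 1 ∧
      (∀ k : Fin (d + 1), (k : ℕ) ≠ 0 → (k : ℕ) ≠ d → r' k ≤ r k) ∧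
      ∃ G : (k : Fin d) → Fin (r' k.castSucc) → Fin (n k) → Fin (r' k.succ) → ℝ,
        ∀ i, A i = ∑ α : ((k : Fin (d + 1)) → Fin (r' k)),
          ∏ k : Fin d, G k (α k.castSucc) (i k) (α k.succ) := by
  have hfam : ∀ k : Fin (d + 1), ∃ (m : ℕ) (b : Fin m → ((i : Fin d) → Fin (n i)) → ℝ),
      unfoldingRowSpace A k ≤ Submodule.span ℝ (Set.range b) ∧
      ((k : ℕ) ≠ d → ∀ a, b a ∈ unfoldingRowSpace A k) ∧
      ((k : ℕ) = 0 → m = 1 ∧ ∀ a, b a = A) ∧ ((k : ℕ) = d → m = 1 ∧ ∀ a, b a = 1) ∧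
      ((k : ℕ) ≠ 0 → (k : ℕ) ≠ d → m ≤ r k) := by
    intro k
    by_cases h0 : (k : ℕ) = 0
    · refine ⟨1, fun _ => A, ?_, fun _ _ => ?_, fun _ => ⟨rfl, fun _ => rfl⟩, by omega, by omega⟩
      · rw [Set.range_const, h0, unfoldingRowSpace, Submodule.span_le]
        rintro _ ⟨x, rfl⟩
        simp
      · rw [h0]
        exact mem_unfoldingRowSpace_zero A
    by_cases h1 : (k : ℕ) = d
    · refine ⟨1, fun _ => 1, ?_, by omega, by omega, fun _ => ⟨rfl, fun _ => rfl⟩, by omega⟩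
      rw [Set.range_const, h1]
      exact unfoldingRowSpace_le_span_one A
    · let B := Module.finBasis ℝ (unfoldingRowSpace A k)
      refine ⟨_, fun a => (B a : _), ?_, fun _ a => (B a).2, by omega, by omega,
        fun _ _ => (finrank_unfoldingRowSpace_le A k).trans (hrank k)⟩
      intro f hf
      have h := Submodule.mem_map_of_mem (f := (unfoldingRowSpace A k).subtype) (B.mem_span ⟨f, hf⟩)
      rw [Submodule.map_span, ← Set.range_comp] at h
      exact h
  choose r' b hspan hmem hzero hlast hle using hfam
  have hr0 := hzero 0 rfl
  have hrd := hlast (Fin.last d) rfl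
  have hcoeff : ∀ (k : Fin d) (a : Fin (r' k.castSucc)) (j : Fin (n k)),
      ∃ c : Fin (r' k.succ) → ℝ,
        ∑ e, c e • b k.succ e = fun y => b k.castSucc a (Function.update y k j) := by
    intro k a j
    refine (Submodule.mem_span_range_iff_exists_fun ℝ).1 (hspan k.succ ?_)
    exact comp_update_mem_unfoldingRowSpace j (hmem k.castSucc k.2.ne a)
  choose G hG using hcoeff
  refine ⟨r', hr0.1, hrd.1, hle, G, fun i => ?_⟩
  have key := sum_prod_mul_eq_sum_mul_of_recurrence (fun k => Fin (r' k)) (fun k a => b k a i)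
    (fun k a e => G k a (i k) e)
    (fun k a => by simpa using (congrFun (hG k a (i k)) i).symm) (fun _ => 1)
  simpa [hr0.1, hr0.2, hrd.2] using key.symm
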